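/- Let Φ(ρ) = Σ_{i=1}^N pᵢ Uᵢ ρ Uᵢ* be a mixed unitary channel on 3×3 complex matrices (pᵢ > 0, Σ pᵢ = 1, Uᵢ unitary), and for k ∈ Fin 3 let E_kk denote the standard basis matrix with a single 1 in position (k,k) (the density operator of the basis state |k⟩). Then F(Φ(E_kk), Φ(E_ll)) = 0 for all k ≠ l in Fin 3 if and only if Uⱼ*Uᵢ is a diagonal matrix for all 1 ≤ i, j ≤ N. -/

import Mathlib

open Matrix ComplexOrder

/-- The positive semidefinite square root of a positive semidefinite matrix
(Mathlib's former `Matrix.PosSemidef.sqrt`, with its old definition). -/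
noncomputable def Matrix.PosSemidef.sqrt {n 𝕜 : Type*} [Fintype n] [RCLike 𝕜] [DecidableEq n]
    {A : Matrix n n 𝕜} (hA : A.PosSemidef) : Matrix n n 𝕜 :=
  hA.1.eigenvectorUnitary.1 * diagonal ((↑) ∘ Real.sqrt ∘ hA.1.eigenvalues) *
    (star hA.1.eigenvectorUnitary : Matrix n n 𝕜)

/-- The positive semidefinite square root of a matrix (junk value `0` if not PSD). -/
noncomputable def psdSqrt {n : Type*} [Fintype n] [DecidableEq n]
    (A : Matrix n n ℂ) : Matrix n n ℂ :=
  letI := Classical.propDecidable A.PosSemidef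
  if h : A.PosSemidef then h.sqrt else 0

/-- Fidelity `F(ρ,σ) = tr √(√σ ρ √σ)`. -/
noncomputable def fid {n : Type*} [Fintype n] [DecidableEq n]
    (ρ σ : Matrix n n ℂ) : ℝ :=
  (psdSqrt (psdSqrt σ * ρ * psdSqrt σ)).trace.re

/-- Trace norm `‖M‖₁ = tr √(M* M)`. -/
noncomputable def traceNorm {n : Type*} [Fintype n] [DecidableEq n]
    (M : Matrix n n ℂ) : ℝ :=
  (psdSqrt (Mᴴ * M)).trace.re

/-- Inner product on `ℂ^ι`, conjugate-linear in the first argument. -/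
noncomputable def cinner {ι : Type*} [Fintype ι] (x y : ι → ℂ) : ℂ := star x ⬝ᵥ y

/-- Rank-one density operator `φφ*` of a vector `φ`. -/
noncomputable def outer {ι : Type*} [Fintype ι] (φ : ι → ℂ) : Matrix ι ι ℂ :=
  vecMulVec φ (star φ)

theorem psdSqrt_posSemidef {n : Type*} [Fintype n] [DecidableEq n]
    (A : Matrix n n ℂ) : (psdSqrt A).PosSemidef := by
  unfold psdSqrt
  split_ifs with h
  · unfold Matrix.PosSemidef.sqrt
    apply Matrix.PosSemidef.mul_mul_conjTranspose_same
    apply Matrix.PosSemidef.diagonal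
    intro i
    simp [Real.sqrt_nonneg]
  · exact Matrix.PosSemidef.zero

theorem psdSqrt_mul_self {n : Type*} [Fintype n] [DecidableEq n]
    {A : Matrix n n ℂ} (h : A.PosSemidef) : psdSqrt A * psdSqrt A = A := by
  unfold psdSqrt
  rw [dif_pos h]
  unfold Matrix.PosSemidef.sqrt
  have hs : (star h.1.eigenvectorUnitary : Matrix n n ℂ) * h.1.eigenvectorUnitary.1 = 1 := by
    simp
  have hsp := h.1.spectral_theorem
  rw [Unitary.conjStarAlgAut_apply] at hsp
  have hd : diagonal (RCLike.ofReal ∘ Real.sqrt ∘ h.1.eigenvalues) *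
      diagonal (RCLike.ofReal ∘ Real.sqrt ∘ h.1.eigenvalues) =
      (diagonal (RCLike.ofReal ∘ h.1.eigenvalues) : Matrix n n ℂ) := by
    rw [diagonal_mul_diagonal]
    congr 1
    funext i
    simp only [Function.comp]
    rw [← RCLike.ofReal_mul, Real.mul_self_sqrt (h.eigenvalues_nonneg i)]
  calc _ = h.1.eigenvectorUnitary.1 * (diagonal (RCLike.ofReal ∘ Real.sqrt ∘ h.1.eigenvalues) *
      ((star h.1.eigenvectorUnitary : Matrix n n ℂ) * h.1.eigenvectorUnitary.1) *
      diagonal (RCLike.ofReal ∘ Real.sqrt ∘ h.1.eigenvalues)) *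
      (star h.1.eigenvectorUnitary : Matrix n n ℂ) := by simp only [Matrix.mul_assoc]
    _ = A := by
      rw [hs, Matrix.mul_one, hd]
      exact hsp.symm

theorem fid_eq_zero_iff {n : Type*} [Fintype n] [DecidableEq n]
    {ρ σ : Matrix n n ℂ} (hρ : ρ.PosSemidef) (hσ : σ.PosSemidef) :
    fid ρ σ = 0 ↔ (ρ * σ).trace = 0 := by
  have hS := psdSqrt_posSemidef σ
  have hA : (psdSqrt σ * ρ * psdSqrt σ).PosSemidef := by
    have := hρ.mul_mul_conjTranspose_same (psdSqrt σ)
    rwa [hS.1.eq] at this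
  have htr : (psdSqrt σ * ρ * psdSqrt σ).trace = (ρ * σ).trace := by
    rw [Matrix.mul_assoc, Matrix.trace_mul_comm, Matrix.mul_assoc, psdSqrt_mul_self hσ]
  rw [← htr, hA.trace_eq_zero_iff]
  have hT := psdSqrt_posSemidef (psdSqrt σ * ρ * psdSqrt σ)
  have hTT := psdSqrt_mul_self hA
  unfold fid
  constructor
  · intro h0
    have h1 : (psdSqrt (psdSqrt σ * ρ * psdSqrt σ)).trace = 0 := by
      apply Complex.ext h0
      exact (Complex.nonneg_iff.mp hT.trace_nonneg).2.symm
    rw [← hTT, hT.trace_eq_zero_iff.mp h1, Matrix.mul_zero]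
  · intro h0
    rw [h0] at hTT hT ⊢
    have : psdSqrt (0 : Matrix n n ℂ) = 0 := by
      rw [← Matrix.conjTranspose_mul_self_eq_zero, hT.1.eq, hTT]
    simp [this]

theorem trace_single_conj {n : Type*} [Fintype n] [DecidableEq n]
    (A B : Matrix n n ℂ) (k l : n) :
    ((A * Matrix.single k k 1 * Aᴴ) * (B * Matrix.single l l 1 * Bᴴ)).trace =
      ((Complex.normSq ((Bᴴ * A) l k) : ℝ) : ℂ) := by
  have h1 : ((A * Matrix.single k k 1 * Aᴴ) * (B * Matrix.single l l 1 * Bᴴ)).trace =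
      ((Bᴴ * A) * (Matrix.single k k 1 * (Bᴴ * A)ᴴ * Matrix.single l l 1)).trace := by
    rw [conjTranspose_mul, conjTranspose_conjTranspose]
    rw [Matrix.trace_mul_comm (Bᴴ * A), ← Matrix.mul_assoc _ Bᴴ A, Matrix.trace_mul_comm _ A]
    simp only [Matrix.mul_assoc]
  rw [h1, Matrix.single_mul_mul_single, Matrix.trace_mul_single, ← Complex.mul_conj]
  simp [conjTranspose_apply]

theorem channel_posSemidef {N : ℕ} (p : Fin N → ℝ) (hp : ∀ i, 0 < p i)
    (U : Fin N → Matrix (Fin 3) (Fin 3) ℂ) (k : Fin 3) :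
    (∑ i, (p i : ℂ) • (U i * Matrix.single k k 1 * (U i)ᴴ)).PosSemidef := by
  apply Matrix.posSemidef_sum
  intro i _
  apply Matrix.PosSemidef.smul
  · apply Matrix.PosSemidef.mul_mul_conjTranspose_same
    rw [← Matrix.diagonal_single]
    apply Matrix.PosSemidef.diagonal
    intro j
    by_cases h : j = k
    · subst h; simp
    · simp [h]
  · exact_mod_cast (hp i).le

theorem stmt5 (N : ℕ) (hN : 1 ≤ N) (p : Fin N → ℝ) (hp : ∀ i, 0 < p i)
    (hpsum : ∑ i, p i = 1)
    (U : Fin N → Matrix (Fin 3) (Fin 3) ℂ) (hU : ∀ i, (U i)ᴴ * U i = 1) :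
    (∀ k l : Fin 3, k ≠ l →
      fid (∑ i, (p i : ℂ) • (U i * Matrix.single k k 1 * (U i)ᴴ))
          (∑ i, (p i : ℂ) • (U i * Matrix.single l l 1 * (U i)ᴴ)) = 0) ↔
      ∀ i j, ((U j)ᴴ * U i).IsDiag := by
  have key : ∀ k l : Fin 3,
      fid (∑ i, (p i : ℂ) • (U i * Matrix.single k k 1 * (U i)ᴴ))
          (∑ i, (p i : ℂ) • (U i * Matrix.single l l 1 * (U i)ᴴ)) = 0 ↔
      ∀ i j, ((U j)ᴴ * U i) l k = 0 := by
    intro k l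
    rw [fid_eq_zero_iff (channel_posSemidef p hp U k) (channel_posSemidef p hp U l)]
    have htr : ((∑ i, (p i : ℂ) • (U i * Matrix.single k k 1 * (U i)ᴴ)) *
          (∑ i, (p i : ℂ) • (U i * Matrix.single l l 1 * (U i)ᴴ))).trace =
        ((∑ i, ∑ j, p i * p j * Complex.normSq (((U j)ᴴ * U i) l k) : ℝ) : ℂ) := by
      rw [Finset.sum_mul_sum]
      simp only [Matrix.trace_sum, Matrix.smul_mul, Matrix.mul_smul, Matrix.trace_smul,
        trace_single_conj]
      push_cast
      simp only [smul_eq_mul]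
      refine Finset.sum_congr rfl fun i _ => Finset.sum_congr rfl fun j _ => by ring
    rw [htr, Complex.ofReal_eq_zero]
    have hnn : ∀ i j, 0 ≤ p i * p j * Complex.normSq (((U j)ᴴ * U i) l k) := fun i j =>
      mul_nonneg (mul_pos (hp i) (hp j)).le (Complex.normSq_nonneg _)
    rw [Finset.sum_eq_zero_iff_of_nonneg (fun i _ => Finset.sum_nonneg fun j _ => hnn i j)]
    constructor
    · intro h i j
      have h1 := (Finset.sum_eq_zero_iff_of_nonneg (fun j _ => hnn i j)).mp
        (h i (Finset.mem_univ i)) j (Finset.mem_univ j)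
      rcases mul_eq_zero.mp h1 with h2 | h2
      · exact absurd h2 (mul_pos (hp i) (hp j)).ne'
      · exact Complex.normSq_eq_zero.mp h2
    · intro h i _
      refine Finset.sum_eq_zero fun j _ => ?_
      rw [h i j]
      simp
  constructor
  · intro h i j l k hlk
    exact (key k l).mp (h k l hlk.symm) i j
  · intro h k l hkl
    exact (key k l).mpr fun i j => h i j hkl.symm
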